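/- arXiv:2401.16739 — 4 statements merged into one kernel-verified Lean document; each statement's English description precedes it below -/
import Mathlib

section
/- Let r, a, b be integers with r ≥ 2 and r ≤ a ≤ 2r − 2 and r ≤ b ≤ 2r − 2. Then C(a, r) + C(b, r) < C(a+b−1, r−1). -/
theorem Nat.choose_succ_le_choose {n k : ℕ} (h : n ≤ 2 * k + 1) :
    n.choose (k + 1) ≤ n.choose k := by
  refine Nat.le_of_mul_le_mul_right ?_ k.succ_pos
  rw [Nat.succ_eq_add_one, Nat.choose_succ_right_eq]
  exact Nat.mul_le_mul_left _ (by omega)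

theorem Nat.choose_succ_lt_choose {n k : ℕ} (hk : k ≤ n) (h : n ≤ 2 * k) :
    n.choose (k + 1) < n.choose k := by
  refine Nat.lt_of_mul_lt_mul_right (a := k + 1) ?_
  rw [Nat.choose_succ_right_eq]
  exact Nat.mul_lt_mul_of_pos_left (by omega) (Nat.choose_pos hk)

/-- If `r ≥ 2` and `r ≤ a ≤ 2r − 2`, `r ≤ b ≤ 2r − 2`, then
`C(a, r) + C(b, r) < C(a+b−1, r−1)`. -/
theorem choose_add_choose_lt'' (r a b : ℕ) (hr : 2 ≤ r) (hra : r ≤ a) (ha : a ≤ 2 * r - 2)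
    (hrb : r ≤ b) (hb : b ≤ 2 * r - 2) :
    Nat.choose a r + Nat.choose b r < Nat.choose (a + b - 1) (r - 1) := by
  wlog hab : b ≤ a generalizing a b
  · rw [add_comm (a.choose r), add_comm a]
    exact this b a hrb hb hra ha (by omega)
  obtain ⟨s, rfl⟩ : ∃ s, r = s + 1 := ⟨r - 1, by omega⟩
  calc a.choose (s + 1) + b.choose (s + 1)
      ≤ a.choose (s + 1) + a.choose (s + 1) := by gcongr
    _ < a.choose s + a.choose (s + 1) := by
      gcongr
      exact Nat.choose_succ_lt_choose (by omega) (by omega)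
    _ = (a + 1).choose (s + 1) := (Nat.choose_succ_succ a s).symm
    _ ≤ (a + 1).choose s := Nat.choose_succ_le_choose (by omega)
    _ ≤ (a + b - 1).choose (s + 1 - 1) := Nat.choose_le_choose s (by omega)
end

section
/- Let r ≥ 3 and c ≥ 2 be integers. Then c·C(2r−1, r−1) < C(c·(2r−1) − 1, r−1). -/
/-- If `3 ≤ n`, `2 ≤ c` and `2 ≤ k ≤ n`, then scaling `n` by `c` (and subtracting one) multiplies
the descending factorial by more than `c`. -/
lemma mul_descFactorial_lt {n c k : ℕ} (hn : 3 ≤ n) (hc : 2 ≤ c) (hk : 2 ≤ k) (hkn : k ≤ n) :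
    c * n.descFactorial k < (c * n - 1).descFactorial k := by
  obtain ⟨j, rfl⟩ := Nat.exists_eq_add_of_le' hk
  obtain ⟨m, rfl⟩ := Nat.exists_eq_add_of_le' (hk.trans hkn)
  have hcm : 2 * (m + 2) ≤ c * (m + 2) := Nat.mul_le_mul_right _ hc
  obtain ⟨N, hN⟩ : ∃ N, c * (m + 2) = N + 3 := ⟨c * (m + 2) - 3, by omega⟩
  have hpred : c * (m + 2) - 1 = N + 2 := by omega
  have hpos : 0 < m.descFactorial j := Nat.descFactorial_pos.2 (by omega)
  have hle : m.descFactorial j ≤ N.descFactorial j := Nat.descFactorial_le j (by omega)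
  have hlt : c * (m + 2) * (m + 1) < (N + 2) * (N + 1) := by
    rw [hN]
    nlinarith
  rw [hpred]
  simp only [Nat.succ_descFactorial_succ]
  calc c * ((m + 1 + 1) * ((m + 1) * m.descFactorial j))
      = c * (m + 2) * (m + 1) * m.descFactorial j := by ring
    _ < (N + 2) * (N + 1) * m.descFactorial j := Nat.mul_lt_mul_of_pos_right hlt hpos
    _ ≤ (N + 2) * (N + 1) * N.descFactorial j := Nat.mul_le_mul_left _ hle
    _ = (N + 1 + 1) * ((N + 1) * N.descFactorial j) := by ring

/-- If `r ≥ 3` and `c ≥ 2`, then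
`c·C(2r−1, r−1) < C(c·(2r−1) − 1, r−1)`. -/
theorem mul_choose_lt (r c : ℕ) (hr : 3 ≤ r) (hc : 2 ≤ c) :
    c * Nat.choose (2 * r - 1) (r - 1) < Nat.choose (c * (2 * r - 1) - 1) (r - 1) := by
  have h := mul_descFactorial_lt (n := 2 * r - 1) (k := r - 1) (by omega) hc (by omega) (by omega)
  rw [Nat.descFactorial_eq_factorial_mul_choose, Nat.descFactorial_eq_factorial_mul_choose,
    Nat.mul_left_comm] at h
  exact Nat.lt_of_mul_lt_mul_left h
end

section
/- Let r ≥ 2, a, b be integers with a ≥ 2r and b ≥ 2r − 1, and define f(b) = C(b, r) if b ≤ 2r − 1 and f(b) = C(b−1, r−1) if b ≥ 2r. Then C(a−1, r−1) + f(b) ≤ C(a+b−1, r−1). -/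
/-- For a positive lower index, binomial coefficients are superadditive in the upper index. -/
theorem Nat.choose_succ_add_choose_succ_le (m n k : ℕ) :
    m.choose (k + 1) + n.choose (k + 1) ≤ (m + n).choose (k + 1) := by
  induction n with
  | zero => simp
  | succ n ih =>
    have h : n.choose k ≤ (m + n).choose k := Nat.choose_le_choose k (Nat.le_add_left n m)
    rw [← Nat.add_assoc, Nat.choose_succ_succ', Nat.choose_succ_succ']
    omega

/-- Let `r ≥ 2`, `a ≥ 2r`, `b ≥ 2r − 1`, and define
`f(b) = C(b, r)` if `b ≤ 2r − 1` and `f(b) = C(b−1, r−1)` if `b ≥ 2r`. Then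
`C(a−1, r−1) + f(b) ≤ C(a+b−1, r−1)`. -/
theorem choose_add_f_le (r a b : ℕ) (hr : 2 ≤ r) (ha : 2 * r ≤ a) (hb : 2 * r - 1 ≤ b) :
    Nat.choose (a - 1) (r - 1) +
      (if b ≤ 2 * r - 1 then Nat.choose b r else Nat.choose (b - 1) (r - 1)) ≤
      Nat.choose (a + b - 1) (r - 1) := by
  obtain ⟨k, rfl⟩ := Nat.exists_eq_add_of_le' hr
  obtain ⟨a, rfl⟩ := Nat.exists_eq_add_of_le' (show 1 ≤ a by omega)
  have hsub : k + 2 - 1 = k + 1 := rfl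
  rw [hsub, Nat.add_sub_cancel]
  split_ifs with h
  · have hsymm : b.choose (k + 2) = b.choose (k + 1) :=
      Nat.choose_symm_of_eq_add (by omega)
    rw [hsymm, show a + 1 + b - 1 = a + b by omega]
    exact Nat.choose_succ_add_choose_succ_le a b k
  · exact (Nat.choose_succ_add_choose_succ_le a (b - 1) k).trans
      (Nat.choose_le_choose _ (by omega))
end

section
/- Let r ≥ 3 and k ≥ 2 be integers, and let m_1, …, m_k be integers with m_i ≥ r for all i and m_1 + ⋯ + m_k = n. Define f(m) = C(m, r) if r ≤ m ≤ 2r − 1 and f(m) = C(m−1, r−1) if m ≥ 2r. Then f(m_1) + ⋯ + f(m_k) < C(n−1, r−1). -/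
/-- A strict superadditivity estimate for binomial coefficients, from Vandermonde's identity. -/
theorem Nat.choose_add_choose_lt_choose_add_sub_one {s a b : ℕ} (hs : 2 ≤ s) (ha : s ≤ a)
    (hb : 2 ≤ b) : a.choose s + b.choose s < (a + b - 1).choose s := by
  obtain ⟨t, rfl⟩ : ∃ t, s = t + 1 := ⟨s - 1, by omega⟩
  obtain ⟨c, rfl⟩ : ∃ c, a = c + 1 := ⟨a - 1, by omega⟩
  have hsub : ({(t + 1, 0), (1, t), (0, t + 1)} : Finset (ℕ × ℕ)) ⊆
      Finset.HasAntidiagonal.antidiagonal (t + 1) := by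
    intro p hp
    simp only [Finset.mem_insert, Finset.mem_singleton] at hp
    rcases hp with rfl | rfl | rfl <;> simp [add_comm]
  have hle := Finset.sum_le_sum_of_subset (f := fun p : ℕ × ℕ ↦ b.choose p.1 * c.choose p.2) hsub
  rw [← Nat.add_choose_eq, Finset.sum_insert (by simp; omega), Finset.sum_insert (by simp),
    Finset.sum_singleton] at hle
  simp only [Nat.choose_zero_right, Nat.choose_one_right, mul_one, one_mul] at hle
  have hpos : 0 < c.choose t := Nat.choose_pos (by omega)
  have hmul : 2 * c.choose t ≤ b * c.choose t := Nat.mul_le_mul_right _ hb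
  rw [Nat.choose_succ_succ' c t, show c + 1 + b - 1 = b + c by omega]
  omega

theorem Nat.ite_choose_le_choose_sub_one {r : ℕ} (hr : 1 ≤ r) (m : ℕ) :
    (if m ≤ 2 * r - 1 then m.choose r else (m - 1).choose (r - 1)) ≤ m.choose (r - 1) := by
  split_ifs with h
  · obtain ⟨t, rfl⟩ : ∃ t, r = t + 1 := ⟨r - 1, by omega⟩
    refine Nat.le_of_mul_le_mul_right ?_ t.succ_pos
    rw [Nat.succ_eq_add_one, Nat.choose_succ_right_eq]
    exact Nat.mul_le_mul_left _ (by omega)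
  · exact Nat.choose_le_choose _ (Nat.sub_le m 1)

theorem Fin.sum_lt_apply_sum_of_superadditive {r : ℕ} {f : ℕ → ℕ}
    (hf : ∀ a b, r ≤ a → r ≤ b → f a + f b < f (a + b)) (k : ℕ) (m : Fin (k + 2) → ℕ)
    (hm : ∀ i, r ≤ m i) : ∑ i, f (m i) < f (∑ i, m i) := by
  induction k with
  | zero => simpa [Fin.sum_univ_two] using hf _ _ (hm 0) (hm 1)
  | succ k ih =>
    rw [Fin.sum_univ_succ, Fin.sum_univ_succ m]
    have htail := ih (fun i ↦ m i.succ) fun i ↦ hm i.succ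
    have hle : r ≤ ∑ i : Fin (k + 2), m i.succ :=
      (hm _).trans (Finset.single_le_sum (f := fun i : Fin (k + 2) ↦ m i.succ)
        (fun _ _ ↦ Nat.zero_le _) (Finset.mem_univ 0))
    have hhead := hf _ _ (hm 0) hle
    omega


/-- Let `r ≥ 3`, `k ≥ 2` and `m₁, …, m_k` be integers with `m_i ≥ r`
for all `i` and `m₁ + ⋯ + m_k = n`.  With `f(m) = C(m, r)` for `r ≤ m ≤ 2r − 1` and
`f(m) = C(m−1, r−1)` for `m ≥ 2r`, we have `f(m₁) + ⋯ + f(m_k) < C(n−1, r−1)`. -/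
theorem sum_f_lt_choose (r k n : ℕ) (hr : 3 ≤ r) (hk : 2 ≤ k) (m : Fin k → ℕ)
    (hm : ∀ i, r ≤ m i) (hsum : ∑ i, m i = n) :
    ∑ i, (if m i ≤ 2 * r - 1 then Nat.choose (m i) r else Nat.choose (m i - 1) (r - 1)) <
      Nat.choose (n - 1) (r - 1) := by
  obtain ⟨k, rfl⟩ : ∃ l, k = l + 2 := ⟨k - 2, by omega⟩
  have hn : 2 * r ≤ n := by
    rw [← hsum, Fin.sum_univ_succ, Fin.sum_univ_succ]
    have h₀ := hm 0
    have h₁ := hm (Fin.succ 0)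
    omega
  have key := Fin.sum_lt_apply_sum_of_superadditive (r := r)
    (f := fun m ↦ if m ≤ 2 * r - 1 then m.choose r else (m - 1).choose (r - 1)) ?_ k m hm
  · simpa only [hsum, if_neg (show ¬ n ≤ 2 * r - 1 by omega)] using key
  · intro a b ha hb
    rw [if_neg (show ¬ a + b ≤ 2 * r - 1 by omega)]
    exact (Nat.add_le_add (Nat.ite_choose_le_choose_sub_one (by omega) a)
      (Nat.ite_choose_le_choose_sub_one (by omega) b)).trans_lt
      (Nat.choose_add_choose_lt_choose_add_sub_one (by omega) (by omega) (by omega))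
end
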